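/- Let G=(V,E) be a finite simple undirected graph with preferences as described, assume P≠∅, let x∈P, and let σ be a strongly stable matching in G. Let v ∈ P', w ∈ Q', and let e={v,w} be an edge with e ∈ W_x(v). Then x(W_x(v)) = x(B_x(w)). -/

import Mathlib

/-!
Common setup: a finite simple undirected graph `G = (V, E)` where edges are
elements of `Sym2 V`, together with, for each vertex `v`, a complete and
transitive preference relation `pref v` on `E(v) ∪ {∅}` (the unmatched
option `∅` is encoded as `none : Option (Sym2 V)`), where every incident
edge is strictly preferred to `∅`.
-/

/-- A roommates instance: a finite simple graph with preferences. -/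
structure RSetup (V : Type*) [Fintype V] [DecidableEq V] where
  /-- the edge set -/
  E : Finset (Sym2 V)
  /-- the graph is simple: no loops -/
  not_diag : ∀ e ∈ E, ¬ e.IsDiag
  /-- the preference relation `≿ᵥ` of each vertex, on `E(v) ∪ {∅}` -/
  pref : V → Option (Sym2 V) → Option (Sym2 V) → Prop
  /-- completeness of `≿ᵥ` on `E(v) ∪ {∅}` -/
  pref_total : ∀ v : V, ∀ a b : Option (Sym2 V),
    (∀ e, a = some e → e ∈ E ∧ v ∈ e) → (∀ e, b = some e → e ∈ E ∧ v ∈ e) →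
    pref v a b ∨ pref v b a
  /-- transitivity of `≿ᵥ` on `E(v) ∪ {∅}` -/
  pref_trans : ∀ v : V, ∀ a b c : Option (Sym2 V),
    (∀ e, a = some e → e ∈ E ∧ v ∈ e) → (∀ e, b = some e → e ∈ E ∧ v ∈ e) →
    (∀ e, c = some e → e ∈ E ∧ v ∈ e) →
    pref v a b → pref v b c → pref v a c
  /-- every incident edge is strictly preferred to being unmatched -/
  pref_none : ∀ v : V, ∀ e ∈ E, v ∈ e →
    pref v (some e) none ∧ ¬ pref v none (some e)

namespace RSetup

variable {V : Type*} [Fintype V] [DecidableEq V] (S : RSetup V)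

/-- `a ≻ᵥ b` : strict preference. -/
def SPref (v : V) (a b : Option (Sym2 V)) : Prop :=
  S.pref v a b ∧ ¬ S.pref v b a

/-- `a ∼ᵥ b` : indifference. -/
def IPref (v : V) (a b : Option (Sym2 V)) : Prop :=
  S.pref v a b ∧ S.pref v b a

/-- `F(v)` : the set of edges in `F` incident to `v`. -/
def inc (F : Finset (Sym2 V)) (v : V) : Finset (Sym2 V) :=
  F.filter (fun e => v ∈ e)

/-- a matching in `G` -/
def IsMatching (μ : Finset (Sym2 V)) : Prop :=
  μ ⊆ S.E ∧ ∀ v : V, (inc μ v).card ≤ 1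

/-- `μ(v)` : the edge of `μ` incident to `v` (or `none`). -/
noncomputable def matchOf (μ : Finset (Sym2 V)) (v : V) : Option (Sym2 V) :=
  (inc μ v).toList.head?

/-- `e` blocks the matching `μ`. -/
def Blocks (μ : Finset (Sym2 V)) (e : Sym2 V) : Prop :=
  e ∈ S.E ∧ e ∉ μ ∧ (∀ v ∈ e, S.pref v (some e) (matchOf μ v)) ∧
    (∃ v ∈ e, S.SPref v (some e) (matchOf μ v))

/-- a strongly stable matching in `G` -/
def StronglyStable (μ : Finset (Sym2 V)) : Prop :=
  S.IsMatching μ ∧ ∀ e : Sym2 V, ¬ S.Blocks μ e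

/-- `x(W) = ∑_{e ∈ W} x(e)` -/
def xS (x : Sym2 V → ℝ) (W : Finset (Sym2 V)) : ℝ := ∑ e ∈ W, x e

/-- `x ∈ ℝ₊^E`, encoded as a nonnegative function on `Sym2 V` vanishing
outside `E`. -/
def IsVec (x : Sym2 V → ℝ) : Prop :=
  (∀ e, 0 ≤ x e) ∧ ∀ e ∉ S.E, x e = 0

open Classical in
/-- `E[∼ᵥ e] = {f ∈ E(v) : f ∼ᵥ e}` -/
noncomputable def simSet (v : V) (e : Sym2 V) : Finset (Sym2 V) :=
  (inc S.E v).filter (fun f => S.IPref v (some f) (some e))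

open Classical in
/-- `E[≻ᵥ e] = {f ∈ E(v) : f ≻ᵥ e}` -/
noncomputable def succSet (v : V) (e : Sym2 V) : Finset (Sym2 V) :=
  (inc S.E v).filter (fun f => S.SPref v (some f) (some e))

open Classical in
/-- `E⟨X⟩ = {e ∈ E : e ⊆ X}` -/
noncomputable def esub (X : Finset V) : Finset (Sym2 V) :=
  S.E.filter (fun e => ∀ u ∈ e, u ∈ X)

/-- constraint (1): `x(E(v)) ≤ 1` for every vertex `v` -/
def C1 (x : Sym2 V → ℝ) : Prop := ∀ v : V, xS x (inc S.E v) ≤ 1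

/-- constraint (2): `x(E[∼ᵥ e]) + ∑_{w ∈ e} x(E[≻_w e]) ≥ 1`
for every edge `e ∈ E` and `v ∈ e` -/
def C2 (x : Sym2 V → ℝ) : Prop := ∀ v w : V, s(v, w) ∈ S.E →
  xS x (S.simSet v s(v, w)) +
    (xS x (S.succSet v s(v, w)) + xS x (S.succSet w s(v, w))) ≥ 1

/-- constraint (3): `x(E⟨X⟩) ≤ ⌊|X|/2⌋` for every odd `X ⊆ V` -/
def C3 (x : Sym2 V → ℝ) : Prop := ∀ X : Finset V, Odd X.card →
  xS x (S.esub X) ≤ ((X.card / 2 : ℕ) : ℝ)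

/-- membership in the polytope `P` -/
def memP (x : Sym2 V → ℝ) : Prop := S.IsVec x ∧ S.C1 x ∧ S.C2 x ∧ S.C3 x

/-- the characteristic vector `χ_μ` of a set of edges -/
def chi (μ : Finset (Sym2 V)) : Sym2 V → ℝ := fun e => if e ∈ μ then 1 else 0

open Classical in
/-- `E_x = {e ∈ E : x(e) > 0}` -/
noncomputable def supp (x : Sym2 V → ℝ) : Finset (Sym2 V) :=
  S.E.filter (fun e => 0 < x e)

/-- `V₁` : the set of vertices `v` with `x(E(v)) > 0` for some `x ∈ P` -/
def V1 : Set V := {v : V | ∃ x : Sym2 V → ℝ, S.memP x ∧ 0 < xS x (inc S.E v)}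

open Classical in
/-- `B_x(v)` : the best edges in `E_x(v)` for `v` -/
noncomputable def Bset (x : Sym2 V → ℝ) (v : V) : Finset (Sym2 V) :=
  (inc (S.supp x) v).filter
    (fun e => ∀ f ∈ inc (S.supp x) v, S.pref v (some e) (some f))

open Classical in
/-- `W_x(v)` : the worst edges in `E_x(v)` for `v` -/
noncomputable def Wset (x : Sym2 V → ℝ) (v : V) : Finset (Sym2 V) :=
  (inc (S.supp x) v).filter
    (fun e => ∀ f ∈ inc (S.supp x) v, S.pref v (some f) (some e))

/-- a nonempty `F ⊆ E(v)` is flat if `v` is indifferent among its members -/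
def Flat (v : V) (F : Finset (Sym2 V)) : Prop :=
  F.Nonempty ∧ ∀ e ∈ F, ∀ f ∈ F, S.IPref v (some e) (some f)

open Classical in
/-- `T_x` : edges `e ∈ E⟨V₁⟩` such that, for each `v ∈ e`, either
`e ∈ B_x(v) ∪ W_x(v)` or `B_x(v) ≻ᵥ e ≻ᵥ W_x(v)`. -/
noncomputable def Tset (x : Sym2 V → ℝ) : Finset (Sym2 V) :=
  (S.E.filter (fun e => ∀ u ∈ e, u ∈ S.V1)).filter (fun e => ∀ v ∈ e,
    (e ∈ S.Bset x v ∪ S.Wset x v) ∨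
      ((∀ f ∈ S.Bset x v, S.SPref v (some f) (some e)) ∧
        (∀ f ∈ S.Wset x v, S.SPref v (some e) (some f))))

/-- membership in `P(F) = {x ∈ P : x(e) = 0 for all e ∈ E \ F}` -/
def memPF (F : Finset (Sym2 V)) (x : Sym2 V → ℝ) : Prop :=
  S.memP x ∧ ∀ e ∈ S.E, e ∉ F → x e = 0

open Classical in
/-- `E⁺ = {e ∈ E : e ∈ E_z for some z ∈ P}` -/
noncomputable def Eplus : Finset (Sym2 V) :=
  S.E.filter (fun e => ∃ z : Sym2 V → ℝ, S.memP z ∧ 0 < z e)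

open Classical in
/-- `P'` : given `x ∈ P` and a strongly stable matching `σ`, the set of
vertices `v ∈ V₁` with `W_x(v) ≻ᵥ σ(v)`, or with
`B_x(v) ≻ᵥ W_x(v)` and `W_x(v) ∼ᵥ σ(v)`. -/
def Pset (x : Sym2 V → ℝ) (σ : Finset (Sym2 V)) : Set V :=
  {v : V | v ∈ S.V1 ∧
    ((∀ f ∈ S.Wset x v, S.SPref v (some f) (matchOf σ v)) ∨
      ((∀ f ∈ S.Bset x v, ∀ g ∈ S.Wset x v, S.SPref v (some f) (some g)) ∧
        (∀ f ∈ S.Wset x v, S.IPref v (some f) (matchOf σ v))))}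

/-- `Q'` : given `x ∈ P` and a strongly stable matching `σ`, the set of
vertices `v ∈ V₁` with `σ(v) ≻ᵥ B_x(v)`, or with
`B_x(v) ≻ᵥ W_x(v)` and `B_x(v) ∼ᵥ σ(v)`. -/
def Qset (x : Sym2 V → ℝ) (σ : Finset (Sym2 V)) : Set V :=
  {v : V | v ∈ S.V1 ∧
    ((∀ f ∈ S.Bset x v, S.SPref v (matchOf σ v) (some f)) ∨
      ((∀ f ∈ S.Bset x v, ∀ g ∈ S.Wset x v, S.SPref v (some f) (some g)) ∧
        (∀ f ∈ S.Bset x v, S.IPref v (some f) (matchOf σ v))))}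

/-- `R'` : given `x ∈ P` and a strongly stable matching `σ`, the set of
vertices `v ∈ V₁` such that `E_x(v)` is flat and `E_x(v) ∼ᵥ σ(v)`. -/
def Rset (x : Sym2 V → ℝ) (σ : Finset (Sym2 V)) : Set V :=
  {v : V | v ∈ S.V1 ∧ S.Flat v (inc (S.supp x) v) ∧
    ∀ f ∈ inc (S.supp x) v, S.IPref v (some f) (matchOf σ v)}

end RSetup
namespace RSetup

variable {V : Type*} [Fintype V] [DecidableEq V] (S : RSetup V)

lemma mem_inc {F : Finset (Sym2 V)} {v : V} {e : Sym2 V} : e ∈ inc F v ↔ e ∈ F ∧ v ∈ e := by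
  simp [inc]

lemma pref_or_pref {v : V} {e f : Sym2 V} (he : e ∈ inc S.E v) (hf : f ∈ inc S.E v) :
    S.pref v (some e) (some f) ∨ S.pref v (some f) (some e) :=
  S.pref_total v _ _ (fun _ h => Option.some.inj h ▸ mem_inc.1 he)
    (fun _ h => Option.some.inj h ▸ mem_inc.1 hf)

lemma pref_trans_of_mem_inc {v : V} {e f g : Sym2 V} (he : e ∈ inc S.E v) (hf : f ∈ inc S.E v)
    (hg : g ∈ inc S.E v) (hef : S.pref v (some e) (some f)) (hfg : S.pref v (some f) (some g)) :
    S.pref v (some e) (some g) :=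
  S.pref_trans v _ _ _ (fun _ h => Option.some.inj h ▸ mem_inc.1 he)
    (fun _ h => Option.some.inj h ▸ mem_inc.1 hf)
    (fun _ h => Option.some.inj h ▸ mem_inc.1 hg) hef hfg

open Classical in
lemma xS_filter_inc {x : Sym2 V → ℝ} (hx : S.IsVec x) (v : V) (p : Sym2 V → Prop) :
    xS x ((inc S.E v).filter p) = ∑ b, if p s(v, b) then x s(v, b) else 0 := by
  have hinj : Function.Injective (fun b : V => s(v, b)) := fun a b h => Sym2.congr_right.1 h
  have hsum : (∑ b, if p s(v, b) then x s(v, b) else 0)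
      = ∑ f ∈ Finset.univ.image (fun b : V => s(v, b)), if p f then x f else 0 :=
    (Finset.sum_image (f := fun f => if p f then x f else 0) hinj.injOn).symm
  rw [hsum, xS, Finset.sum_filter]
  refine Finset.sum_subset (fun f hf => ?_) (fun f hf hfE => ?_)
  · obtain ⟨b, rfl⟩ := (mem_inc.1 hf).2
    exact Finset.mem_image_of_mem _ (Finset.mem_univ b)
  · obtain ⟨b, -, rfl⟩ := Finset.mem_image.1 hf
    have : s(v, b) ∉ S.E := fun h => hfE (mem_inc.2 ⟨h, Sym2.mem_mk_left v b⟩)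
    simp [hx.2 _ this]

lemma xS_inc {x : Sym2 V → ℝ} (hx : S.IsVec x) (v : V) :
    xS x (inc S.E v) = ∑ b, x s(v, b) := by
  classical
  simpa using S.xS_filter_inc hx v (fun _ => True)

lemma xS_nonneg {x : Sym2 V → ℝ} (hx : S.IsVec x) (F : Finset (Sym2 V)) : 0 ≤ xS x F :=
  Finset.sum_nonneg fun e _ => hx.1 e

lemma sum_mul_simSet_add_succSet {x : Sym2 V → ℝ} (hx : S.IsVec x) (v : V) :
    ∑ w, x s(v, w) * (xS x (S.simSet v s(v, w)) + 2 * xS x (S.succSet v s(v, w)))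
      = xS x (inc S.E v) ^ 2 := by
  classical
  set I : V → V → ℝ := fun b w => if S.IPref v (some s(v, b)) (some s(v, w)) then 1 else 0
  set T : V → V → ℝ := fun b w => if S.SPref v (some s(v, b)) (some s(v, w)) then 1 else 0
  have hI : ∀ w, xS x (S.simSet v s(v, w)) = ∑ b, x s(v, b) * I b w := fun w => by
    rw [simSet, S.xS_filter_inc hx]; simp [I]
  have hT : ∀ w, xS x (S.succSet v s(v, w)) = ∑ b, x s(v, b) * T b w := fun w => by
    rw [succSet, S.xS_filter_inc hx]; simp [T]
  have hswap : ∑ w, ∑ b, x s(v, w) * (x s(v, b) * T b w)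
      = ∑ w, ∑ b, x s(v, w) * (x s(v, b) * T w b) := by
    rw [Finset.sum_comm]
    exact Finset.sum_congr rfl fun _ _ => Finset.sum_congr rfl fun _ _ => by ring
  have htri : ∀ w b, x s(v, w) * (x s(v, b) * (I b w + T b w + T w b))
      = x s(v, w) * x s(v, b) := fun w b => by
    by_cases hw : s(v, w) ∈ S.E
    · by_cases hb : s(v, b) ∈ S.E
      · have htot := S.pref_or_pref (mem_inc.2 ⟨hw, Sym2.mem_mk_left v w⟩)
          (mem_inc.2 ⟨hb, Sym2.mem_mk_left v b⟩)
        have : I b w + T b w + T w b = 1 := by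
          simp only [I, T, IPref, SPref]
          by_cases h1 : S.pref v (some s(v, b)) (some s(v, w)) <;>
            by_cases h2 : S.pref v (some s(v, w)) (some s(v, b)) <;> simp_all
        rw [this, mul_one]
      · simp [hx.2 _ hb]
    · simp [hx.2 _ hw]
  calc _ = ∑ w, ∑ b, x s(v, w) * (x s(v, b) * I b w)
        + (∑ w, ∑ b, x s(v, w) * (x s(v, b) * T b w)
          + ∑ w, ∑ b, x s(v, w) * (x s(v, b) * T b w)) := by
        simp only [hI, hT, ← Finset.mul_sum, ← Finset.sum_add_distrib]
        exact Finset.sum_congr rfl fun _ _ => by ring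
    _ = ∑ w, ∑ b, x s(v, w) * (x s(v, b) * (I b w + T b w + T w b)) := by
        nth_rewrite 2 [hswap]
        simp only [← Finset.sum_add_distrib]
        exact Finset.sum_congr rfl fun _ _ => Finset.sum_congr rfl fun _ _ => by ring
    _ = _ := by
        simp only [htri]
        rw [S.xS_inc hx, sq, Finset.sum_mul_sum]

/-- Complementary slackness of the system with itself: every vertex is covered to extent `0` or `1`,
and the stability constraints of edges in the support are tight. -/
lemma saturated_and_tight {x : Sym2 V → ℝ} (hx : S.memP x) :
    (∀ v, xS x (inc S.E v) ^ 2 = xS x (inc S.E v)) ∧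
      ∀ v w, 0 < x s(v, w) → xS x (S.simSet v s(v, w)) +
        (xS x (S.succSet v s(v, w)) + xS x (S.succSet w s(v, w))) = 1 := by
  obtain ⟨hvec, h1, h2, -⟩ := hx
  set X : V → ℝ := fun v => xS x (inc S.E v)
  set t : V → V → ℝ := fun v w => x s(v, w) * (xS x (S.simSet v s(v, w)) +
    (xS x (S.succSet v s(v, w)) + xS x (S.succSet w s(v, w))) - 1)
  have ht : ∀ v w, 0 ≤ t v w := fun v w => by
    by_cases hE : s(v, w) ∈ S.E
    · exact mul_nonneg (hvec.1 _) (by linarith [h2 v w hE])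
    · simp [t, hvec.2 _ hE]
  have hX : ∀ v, X v ^ 2 - X v ≤ 0 := fun v => by
    nlinarith [S.xS_nonneg hvec (inc S.E v), h1 v]
  have hswap : ∑ v, ∑ w, x s(v, w) * xS x (S.succSet w s(v, w))
      = ∑ v, ∑ w, x s(v, w) * xS x (S.succSet v s(v, w)) := by
    rw [Finset.sum_comm]
    exact Finset.sum_congr rfl fun v _ => Finset.sum_congr rfl fun w _ => by
      rw [Sym2.eq_swap]
  have htotal : ∑ v, ∑ w, t v w = ∑ v, (X v ^ 2 - X v) := by
    calc _ = ∑ v, ∑ w, x s(v, w) * (xS x (S.simSet v s(v, w)) + xS x (S.succSet v s(v, w)) - 1)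
          + ∑ v, ∑ w, x s(v, w) * xS x (S.succSet w s(v, w)) := by
          simp only [← Finset.sum_add_distrib]
          exact Finset.sum_congr rfl fun _ _ => Finset.sum_congr rfl fun _ _ => by
            simp only [t]; ring
      _ = _ := by
          rw [hswap]
          simp only [← Finset.sum_add_distrib, X, ← S.sum_mul_simSet_add_succSet hvec]
          refine Finset.sum_congr rfl fun v _ => ?_
          rw [S.xS_inc hvec, ← Finset.sum_sub_distrib]
          exact Finset.sum_congr rfl fun _ _ => by ring
  have hnonneg : 0 ≤ ∑ v, ∑ w, t v w :=
    Finset.sum_nonneg fun v _ => Finset.sum_nonneg fun w _ => ht v w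
  have hnonpos : ∑ v, (X v ^ 2 - X v) ≤ 0 := Finset.sum_nonpos fun v _ => hX v
  refine ⟨fun v => ?_, fun v w hpos => ?_⟩
  · have := (Finset.sum_eq_zero_iff_of_nonpos fun v _ => hX v).1
      (le_antisymm hnonpos (htotal ▸ hnonneg)) v (Finset.mem_univ v)
    exact sub_eq_zero.1 this
  · have hv := (Finset.sum_eq_zero_iff_of_nonneg
      fun v _ => Finset.sum_nonneg fun w _ => ht v w).1
      (le_antisymm (htotal ▸ hnonpos) hnonneg) v (Finset.mem_univ v)
    have hvw := (Finset.sum_eq_zero_iff_of_nonneg fun w _ => ht v w).1 hv w (Finset.mem_univ w)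
    rcases mul_eq_zero.1 hvw with h | h
    · exact absurd h hpos.ne'
    · exact sub_eq_zero.1 h

lemma mem_inc_supp {x : Sym2 V → ℝ} {v : V} {e : Sym2 V} :
    e ∈ inc (S.supp x) v ↔ e ∈ inc S.E v ∧ 0 < x e := by
  simp [inc, supp, and_right_comm]

lemma mem_simSet {v : V} {e f : Sym2 V} :
    f ∈ S.simSet v e ↔ f ∈ inc S.E v ∧ S.IPref v (some f) (some e) := by
  simp [simSet]

lemma mem_succSet {v : V} {e f : Sym2 V} :
    f ∈ S.succSet v e ↔ f ∈ inc S.E v ∧ S.SPref v (some f) (some e) := by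
  simp [succSet]

lemma mem_Wset {x : Sym2 V → ℝ} {v : V} {e : Sym2 V} : e ∈ S.Wset x v ↔
    e ∈ inc (S.supp x) v ∧ ∀ f ∈ inc (S.supp x) v, S.pref v (some f) (some e) := by
  simp [Wset]

lemma mem_Bset {x : Sym2 V → ℝ} {v : V} {e : Sym2 V} : e ∈ S.Bset x v ↔
    e ∈ inc (S.supp x) v ∧ ∀ f ∈ inc (S.supp x) v, S.pref v (some e) (some f) := by
  simp [Bset]

lemma eq_zero_of_notMem_inc_supp {x : Sym2 V → ℝ} (hx : S.IsVec x) {v : V} {f : Sym2 V}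
    (hf : f ∈ inc S.E v) (h : f ∉ inc (S.supp x) v) : x f = 0 :=
  le_antisymm (not_lt.1 fun hpos => h (S.mem_inc_supp.2 ⟨hf, hpos⟩)) (hx.1 f)

lemma xS_Wset_eq_xS_simSet {x : Sym2 V → ℝ} (hx : S.IsVec x) {v : V} {e : Sym2 V}
    (he : e ∈ S.Wset x v) : xS x (S.Wset x v) = xS x (S.simSet v e) := by
  obtain ⟨hes, hew⟩ := S.mem_Wset.1 he
  have heE := (S.mem_inc_supp.1 hes).1
  refine Finset.sum_subset (fun f hf => ?_) (fun f hf hfW => ?_)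
  · obtain ⟨hfs, hfw⟩ := S.mem_Wset.1 hf
    exact S.mem_simSet.2 ⟨(S.mem_inc_supp.1 hfs).1, hew f hfs, hfw e hes⟩
  · obtain ⟨hfE, -, hef⟩ := S.mem_simSet.1 hf
    refine S.eq_zero_of_notMem_inc_supp hx hfE fun hfs => hfW (S.mem_Wset.2 ⟨hfs, fun g hg => ?_⟩)
    exact S.pref_trans_of_mem_inc (S.mem_inc_supp.1 hg).1 heE hfE (hew g hg) hef

lemma xS_Bset_eq_xS_simSet {x : Sym2 V → ℝ} (hx : S.IsVec x) {v : V} {e : Sym2 V}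
    (he : e ∈ S.Bset x v) : xS x (S.Bset x v) = xS x (S.simSet v e) := by
  obtain ⟨hes, heb⟩ := S.mem_Bset.1 he
  have heE := (S.mem_inc_supp.1 hes).1
  refine Finset.sum_subset (fun f hf => ?_) (fun f hf hfB => ?_)
  · obtain ⟨hfs, hfb⟩ := S.mem_Bset.1 hf
    exact S.mem_simSet.2 ⟨(S.mem_inc_supp.1 hfs).1, hfb e hes, heb f hfs⟩
  · obtain ⟨hfE, hfe, -⟩ := S.mem_simSet.1 hf
    refine S.eq_zero_of_notMem_inc_supp hx hfE fun hfs => hfB (S.mem_Bset.2 ⟨hfs, fun g hg => ?_⟩)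
    exact S.pref_trans_of_mem_inc hfE heE (S.mem_inc_supp.1 hg).1 hfe (heb g hg)

lemma xS_inc_eq_of_mem_Wset {x : Sym2 V → ℝ} (hx : S.IsVec x) {v : V} {e : Sym2 V}
    (he : e ∈ S.Wset x v) :
    xS x (inc S.E v) = xS x (S.simSet v e) + xS x (S.succSet v e) := by
  have hdisj : Disjoint (S.simSet v e) (S.succSet v e) :=
    Finset.disjoint_left.2 fun f h1 h2 => (S.mem_succSet.1 h2).2.2 (S.mem_simSet.1 h1).2.2
  rw [xS, xS, xS, ← Finset.sum_union hdisj]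
  symm
  refine Finset.sum_subset (Finset.union_subset (fun f hf => (S.mem_simSet.1 hf).1)
    (fun f hf => (S.mem_succSet.1 hf).1)) (fun f hf hfn => ?_)
  refine S.eq_zero_of_notMem_inc_supp hx hf fun hfs => hfn ?_
  have hfe := (S.mem_Wset.1 he).2 f hfs
  by_cases hef : S.pref v (some e) (some f)
  · exact Finset.mem_union_left _ (S.mem_simSet.2 ⟨hf, hfe, hef⟩)
  · exact Finset.mem_union_right _ (S.mem_succSet.2 ⟨hf, hfe, hef⟩)

lemma mem_Bset_of_xS_succSet_eq_zero {x : Sym2 V → ℝ} (hx : S.IsVec x) {v : V} {e : Sym2 V}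
    (he : e ∈ inc (S.supp x) v) (h : xS x (S.succSet v e) = 0) : e ∈ S.Bset x v := by
  refine S.mem_Bset.2 ⟨he, fun f hf => ?_⟩
  obtain ⟨hfE, hpos⟩ := S.mem_inc_supp.1 hf
  by_contra hef
  have hfe := (S.pref_or_pref (S.mem_inc_supp.1 he).1 hfE).resolve_left hef
  exact hpos.ne' ((Finset.sum_eq_zero_iff_of_nonneg fun g _ => hx.1 g).1 h f
    (S.mem_succSet.2 ⟨hfE, hfe, hef⟩))

end RSetup

open RSetup in
/-- Lemma 14: for `x ∈ P`, a strongly stable matching `σ`,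
`v ∈ P'`, `w ∈ Q'`, and an edge `e = {v, w} ∈ W_x(v)`, we have
`x(W_x(v)) = x(B_x(w))`. -/
theorem xS_Wset_eq_xS_Bset
    {V : Type*} [Fintype V] [DecidableEq V] (S : RSetup V)
    (hP : ∃ y : Sym2 V → ℝ, S.memP y)
    (x : Sym2 V → ℝ) (hx : S.memP x)
    (σ : Finset (Sym2 V)) (hσ : S.StronglyStable σ)
    (v w : V) (hv : v ∈ S.Pset x σ) (hw : w ∈ S.Qset x σ)
    (he : s(v, w) ∈ S.Wset x v) :
    xS x (S.Wset x v) = xS x (S.Bset x w) := by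
  have hvec := hx.1
  obtain ⟨hsat, htight⟩ := S.saturated_and_tight hx
  have hes := (S.mem_Wset.1 he).1
  obtain ⟨heE, hpos⟩ := S.mem_inc_supp.1 hes
  have hew : s(v, w) ∈ inc (S.supp x) w :=
    S.mem_inc_supp.2 ⟨mem_inc.2 ⟨(mem_inc.1 heE).1, Sym2.mem_mk_right v w⟩, hpos⟩
  have hXpos : 0 < xS x (inc S.E v) :=
    hpos.trans_le (Finset.single_le_sum (f := x) (fun g _ => hvec.1 g) heE)
  have hX : xS x (inc S.E v) = 1 := by
    have := hsat v
    rw [sq] at this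
    exact mul_right_cancel₀ hXpos.ne' (this.trans (one_mul _).symm)
  have hvw := htight v w hpos
  have hwv := htight w v (Sym2.eq_swap (a := v) (b := w) ▸ hpos)
  rw [Sym2.eq_swap (a := w) (b := v)] at hwv
  have hsplit := S.xS_inc_eq_of_mem_Wset hvec he
  have heB := S.mem_Bset_of_xS_succSet_eq_zero hvec hew (by linarith)
  rw [S.xS_Wset_eq_xS_simSet hvec he, S.xS_Bset_eq_xS_simSet hvec heB]
  linarith
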